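/- Let γ = (u₀,…,u_n) ∈ 𝓡(x,y) and γ' = (v₀,…,v_m) ∈ 𝓡(y,z) be right-most paths in ℤ², and set k := min{i : u_i ∈ γ'}, l := max{i : v_i = u_k}, and γ'' := γ * γ' := (u₀,…,u_k, v_{l+1},…,v_m). Then γ'' ∈ 𝓡(x,z) and |∂⁺γ'' ∖ (∂⁺γ ∪ ∂⁺γ')| ≤ 2. -/

import Mathlib

open MeasureTheory ProbabilityTheory Filter Pointwise ENNReal Classical

namespace Perc

/-- Vertices of the square lattice `ℤ²`. -/
abbrev V : Type := ℤ × ℤ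

/-- Edges of `ℤ²`: `(v, false)` is the edge from `v` to `v + (1,0)`,
`(v, true)` is the edge from `v` to `v + (0,1)`.  This is a bijective encoding of the
set `ℰ²` of unordered nearest-neighbour pairs. -/
abbrev Edge : Type := V × Bool

def edgeFst (e : Edge) : V := e.1

def edgeSnd (e : Edge) : V := e.1 + (if e.2 then ((0 : ℤ), (1 : ℤ)) else ((1 : ℤ), (0 : ℤ)))

/-- Nearest-neighbour adjacency in `ℤ²`. -/
def LatticeAdj (x y : V) : Prop := (x.1 - y.1).natAbs + (x.2 - y.2).natAbs = 1

/-- The oriented steps of a path recorded as its list of vertices. -/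
def steps (l : List V) : List (V × V) := l.zip l.tail

/-- The unoriented edge corresponding to an oriented step between adjacent vertices. -/
def stepEdge (s : V × V) : Edge :=
  if s.2 = s.1 + ((1 : ℤ), (0 : ℤ)) then (s.1, false)
  else if s.2 = s.1 + ((0 : ℤ), (1 : ℤ)) then (s.1, true)
  else if s.1 = s.2 + ((1 : ℤ), (0 : ℤ)) then (s.2, false)
  else (s.2, true)

/-- A path in `ℤ²`: a nonempty list of vertices with consecutive vertices adjacent. -/
def IsPath (l : List V) : Prop := l ≠ [] ∧ l.Chain' LatticeAdj

/-- The length (number of edges) of a path. -/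
def pathLen (l : List V) : ℕ := l.length - 1

/-- All edges of the path are open in the configuration `ω`. -/
def IsOpenPath (ω : Edge → Bool) (l : List V) : Prop :=
  ∀ s ∈ steps l, ω (stepEdge s) = true

/-- The four lattice directions in counterclockwise order. -/
def dirVec (k : ℕ) : V :=
  if k % 4 = 0 then ((1 : ℤ), (0 : ℤ)) else if k % 4 = 1 then ((0 : ℤ), (1 : ℤ))
  else if k % 4 = 2 then ((-1 : ℤ), (0 : ℤ)) else ((0 : ℤ), (-1 : ℤ))

def dirIdx (d : V) : ℕ :=
  if d = ((0 : ℤ), (1 : ℤ)) then 1 else if d = ((-1 : ℤ), (0 : ℤ)) then 2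
  else if d = ((0 : ℤ), (-1 : ℤ)) then 3 else 0

/-- The (oriented) right-boundary edges of a path at an interior vertex `cur` with previous
vertex `prev` and next vertex `next`: the oriented edges emanating from `cur`, listed
counterclockwise strictly after `(cur, prev)` and strictly before `(cur, next)`. -/
def rbAt (prev cur next : V) : List (V × V) :=
  let a := dirIdx (prev - cur)
  let b := (dirIdx (next - cur) + 4 - a) % 4
  let b' := if b = 0 then 4 else b
  ((List.range 4).filter fun k => decide (1 ≤ k ∧ k < b')).map
    fun k => (cur, cur + dirVec (a + k))

/-- The right boundary `∂⁺γ` of the path `γ`, as the list of all (oriented) right-boundary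
edges collected at all interior vertices (each visit contributing separately). -/
def rightBoundary : List V → List (V × V)
  | a :: b :: c :: rest => rbAt a b c ++ rightBoundary (b :: c :: rest)
  | _ => []

/-- A right-most path: a simple path (no oriented edge traversed twice) which uses no edge of
its right boundary in either orientation. -/
def IsRightMost (l : List V) : Prop :=
  IsPath l ∧ (steps l).Nodup ∧
    ∀ e ∈ rightBoundary l, e ∉ steps l ∧ (e.2, e.1) ∉ steps l

/-- `InR x y l` : `l` belongs to `𝓡(x,y)`, the set of right-most paths from `x` to `y`. -/
def InR (x y : V) (l : List V) : Prop :=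
  IsRightMost l ∧ l.head? = some x ∧ l.getLast? = some y

/-- The right-boundary length `𝔟(γ)`: the number of open edges of `∂⁺γ` (both orientations
of an edge counting separately). -/
def bLen (ω : Edge → Bool) (l : List V) : ℕ :=
  ((rightBoundary l).filter fun s => ω (stepEdge s)).length

/-- The number `𝔭(γ)` of closed edges used by the path (orientations counted separately). -/
def pLen (ω : Edge → Bool) (l : List V) : ℕ :=
  ((steps l).filter fun s => !(ω (stepEdge s))).length

/-- The right-boundary distance `b(x,y) = inf {𝔟(γ) : γ ∈ 𝓡(x,y) open}`. -/
noncomputable def bDist (ω : Edge → Bool) (x y : V) : ℝ :=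
  sInf {r : ℝ | ∃ l, InR x y l ∧ IsOpenPath ω l ∧ r = (bLen ω l : ℝ)}

/-- `x` and `y` are connected by an open path in `ω`. -/
def ConnectedIn (ω : Edge → Bool) (x y : V) : Prop :=
  ∃ l, IsPath l ∧ IsOpenPath ω l ∧ l.head? = some x ∧ l.getLast? = some y

/-- The open cluster of `x`. -/
def cluster (ω : Edge → Bool) (x : V) : Set V := {y | ConnectedIn ω x y}

/-- The union `C∞` of the infinite open clusters (ℙ-a.s. the unique infinite cluster). -/
def Cinf (ω : Edge → Bool) : Set V := {x | (cluster ω x).Infinite}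

def toR2 (v : V) : ℝ × ℝ := ((v.1 : ℝ), (v.2 : ℝ))

/-- `ℓ∞`-distance between a point of `ℝ²` and a lattice point. -/
noncomputable def distInf (x : ℝ × ℝ) (z : V) : ℝ :=
  max |x.1 - (z.1 : ℝ)| |x.2 - (z.2 : ℝ)|

/-- `ℓ∞`-norm of a lattice vector. -/
noncomputable def normInfV (v : V) : ℝ := max |(v.1 : ℝ)| |(v.2 : ℝ)|

/-- `[x]` : the vertex of `C∞` nearest to `x` in `ℓ∞`-norm, ties broken by minimal `η`. -/
noncomputable def nearest (ω : Edge → Bool) (η : V → ℝ) (x : ℝ × ℝ) : V :=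
  if h : ∃ z, z ∈ Cinf ω ∧ (∀ w ∈ Cinf ω, distInf x z ≤ distInf x w) ∧
      (∀ w ∈ Cinf ω, distInf x w = distInf x z → η z ≤ η w)
  then h.choose else 0

/-- The chemical distance `D_ω(x,y)` (`∞` if `x` and `y` are not connected). -/
noncomputable def chemDist (ω : Edge → Bool) (x y : V) : ℝ≥0∞ :=
  sInf {r : ℝ≥0∞ | ∃ l, IsPath l ∧ IsOpenPath ω l ∧ l.head? = some x ∧
        l.getLast? = some y ∧ r = (pathLen l : ℝ≥0∞)}

/-- The subgraph induced on `U` by the open edges is connected. -/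
def ConnectedInSet (ω : Edge → Bool) (U : Finset V) : Prop :=
  ∀ x ∈ U, ∀ y ∈ U, ∃ l, IsPath l ∧ IsOpenPath ω l ∧ l.head? = some x ∧
    l.getLast? = some y ∧ ∀ v ∈ l, v ∈ U

/-- The edge boundary `∂_{C∞} U`: edges of the graph `C∞` with exactly one endpoint in `U`. -/
def edgeBoundary (ω : Edge → Bool) (U : Set V) : Set Edge :=
  {e | ω e = true ∧ edgeFst e ∈ Cinf ω ∧ edgeSnd e ∈ Cinf ω ∧
        ((edgeFst e ∈ U) ↔ edgeSnd e ∉ U)}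

/-- The anchored isoperimetric profile `Φ_{C∞,0}(r)`. -/
noncomputable def profile (ω : Edge → Bool) (r : ℝ) : ℝ :=
  sInf {q : ℝ | ∃ U : Finset V, (0 : V) ∈ U ∧ ↑U ⊆ Cinf ω ∧ ConnectedInSet ω U ∧
        0 < U.card ∧ (U.card : ℝ) ≤ r ∧
        q = ((edgeBoundary ω ↑U).ncard : ℝ) / (U.card : ℝ)}

/-- The box `B_∞(n) = [-n,n]² ∩ ℤ²`. -/
def box (n : ℕ) : Set V := {x | x.1.natAbs ≤ n ∧ x.2.natAbs ≤ n}

/-- The configuration restricted to the box `B_∞(n)`. -/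
def restrictConf (ω : Edge → Bool) (n : ℕ) : Edge → Bool := fun e =>
  ω e && decide ((edgeFst e).1.natAbs ≤ n) && decide ((edgeFst e).2.natAbs ≤ n)
    && decide ((edgeSnd e).1.natAbs ≤ n) && decide ((edgeSnd e).2.natAbs ≤ n)

/-- `Cⁿ` : a largest open cluster of the configuration restricted to `B_∞(n)`. -/
noncomputable def giant (ω : Edge → Bool) (n : ℕ) : Set V :=
  if h : ∃ x ∈ box n, ∀ y ∈ box n,
      (cluster (restrictConf ω n) y).ncard ≤ (cluster (restrictConf ω n) x).ncard
  then cluster (restrictConf ω n) h.choose else ∅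

/-- The modified Cheeger constant `Φ̃_{Cⁿ} = Φ̃_{Cⁿ,C∞}`. -/
noncomputable def cheeger (ω : Edge → Bool) (n : ℕ) : ℝ :=
  sInf {q : ℝ | ∃ U : Finset V, ↑U ⊆ giant ω n ∧ 0 < U.card ∧
        (U.card : ℝ) ≤ ((giant ω n).ncard : ℝ) / 2 ∧
        q = ((edgeBoundary ω ↑U).ncard : ℝ) / (U.card : ℝ)}

/-- The set `Û_{C∞}(n)` of minimizers of the anchored isoperimetric problem. -/
def profMinimizers (ω : Edge → Bool) (n : ℕ) : Set (Finset V) :=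
  {U | (0 : V) ∈ U ∧ ↑U ⊆ Cinf ω ∧ ConnectedInSet ω U ∧ 0 < U.card ∧
       (U.card : ℝ) ≤ (n : ℝ) ∧
       ((edgeBoundary ω ↑U).ncard : ℝ) / (U.card : ℝ) = profile ω (n : ℝ)}

/-- The set `Û_{Cⁿ}` of minimizers of the modified Cheeger problem. -/
def cheegMinimizers (ω : Edge → Bool) (n : ℕ) : Set (Finset V) :=
  {U | ↑U ⊆ giant ω n ∧ 0 < U.card ∧ (U.card : ℝ) ≤ ((giant ω n).ncard : ℝ) / 2 ∧
       ((edgeBoundary ω ↑U).ncard : ℝ) / (U.card : ℝ) = cheeger ω n}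

/-- The Wulff set `W_p` associated with a boundary norm `β`. -/
def wulff (β : ℝ × ℝ → ℝ) : Set (ℝ × ℝ) :=
  {x | ∀ u : ℝ × ℝ, u.1 ^ 2 + u.2 ^ 2 = 1 → u.1 * x.1 + u.2 * x.2 ≤ β u}

/-- The Wulff shape `Ŵ_p`, normalized to unit Lebesgue area. -/
noncomputable def wulffHat (β : ℝ × ℝ → ℝ) : Set (ℝ × ℝ) :=
  (Real.sqrt ((volume (wulff β)).toReal))⁻¹ • wulff β

/-- Partition sums approximating the `ρ`-length of the curve `γ : [0,1] → ℝ²`. -/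
def lenSums (ρ : ℝ × ℝ → ℝ) (γ : ℝ → ℝ × ℝ) : Set ℝ :=
  {s | ∃ (N : ℕ) (t : ℕ → ℝ), 1 ≤ N ∧ (∀ i < N, t i < t (i + 1)) ∧ 0 ≤ t 0 ∧ t N ≤ 1 ∧
        s = ∑ i ∈ Finset.range N, ρ (γ (t (i + 1)) - γ (t i))}

/-- The `ρ`-length `len_ρ(γ)` of a curve. -/
noncomputable def lenOf (ρ : ℝ × ℝ → ℝ) (γ : ℝ → ℝ × ℝ) : ℝ := sSup (lenSums ρ γ)

/-- A curve is rectifiable if its length (w.r.t. one, hence any, norm on `ℝ²`) is finite. -/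
def Rectifiable (γ : ℝ → ℝ × ℝ) : Prop := BddAbove (lenSums (fun v => ‖v‖) γ)

/-- A Jordan curve: continuous on `[0,1]`, closed, and injective on `[0,1)`. -/
def IsJordan (γ : ℝ → ℝ × ℝ) : Prop :=
  ContinuousOn γ (Set.Icc 0 1) ∧ γ 0 = γ 1 ∧ Set.InjOn γ (Set.Ico 0 1)

/-- The interior of a Jordan curve: the bounded connected component of the complement. -/
def jordanInterior (γ : ℝ → ℝ × ℝ) : Set (ℝ × ℝ) :=
  {x | x ∉ γ '' Set.Icc 0 1 ∧
       Bornology.IsBounded (connectedComponentIn (γ '' Set.Icc 0 1)ᶜ x)}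

/-- The penalty function `h(t) = max (log⁴ t) 1`. -/
noncomputable def hPen (t : ℝ) : ℝ := max ((Real.log t) ^ 4) 1

/-- The modified right-boundary length `𝔟̂(γ) = 𝔟(γ) + h(‖y-x‖) 𝔭(γ)` of a right-most path
from `x` to `y`. -/
noncomputable def bHatLen (ω : Edge → Bool) (x y : V) (l : List V) : ℝ :=
  (bLen ω l : ℝ) + hPen (normInfV (y - x)) * (pLen ω l : ℝ)

/-- The modified right-boundary distance `b̂(x,y)`. -/
noncomputable def bHat (ω : Edge → Bool) (x y : V) : ℝ :=
  sInf {r : ℝ | ∃ l, InR x y l ∧ r = bHatLen ω x y l}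

/-- The set `Γ̂(x,y)` of minimizers of the modified right-boundary distance. -/
def hatMinimizers (ω : Edge → Bool) (x y : V) : Set (List V) :=
  {l | InR x y l ∧ bHatLen ω x y l = bHat ω x y}

/-- The set `Γ_ε(x,y)` of `ε`-optimal open right-most paths. -/
def GammaEps (ω : Edge → Bool) (ε : ℝ) (x y : V) : Set (List V) :=
  {l | InR x y l ∧ IsOpenPath ω l ∧ (bLen ω l : ℝ) - bDist ω x y ≤ ε * normInfV (y - x)}

/-- The set `Γ₀(x,y)` of minimizing open right-most paths. -/
def Gamma0 (ω : Edge → Bool) (x y : V) : Set (List V) :=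
  {l | InR x y l ∧ IsOpenPath ω l ∧ (bLen ω l : ℝ) = bDist ω x y}

/-- Codomains of the coordinate random variables: the edge variables `ω(e)` and the
tie-breaking variables `η_z`. -/
def CoordType : Edge ⊕ V → Type
  | .inl _ => Bool
  | .inr _ => ℝ

noncomputable instance coordMeasurableSpace : ∀ i : Edge ⊕ V, MeasurableSpace (CoordType i)
  | .inl _ => inferInstanceAs (MeasurableSpace Bool)
  | .inr _ => inferInstanceAs (MeasurableSpace ℝ)

/-- The family of all coordinate random variables `(ω(e))_e , (η_z)_z`. -/
def coordMap {Ω : Type} (ωc : Ω → Edge → Bool) (η : Ω → V → ℝ) :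
    ∀ i : Edge ⊕ V, Ω → CoordType i
  | .inl e => fun o => ωc o e
  | .inr z => fun o => η o z


/-- Adjacent vertices differ by one of the four lattice directions. -/
theorem LatticeAdj.exists_dirVec {x y : V} (h : LatticeAdj x y) :
    ∃ i < 4, y = x + dirVec i := by
  obtain ⟨x1, x2⟩ := x
  obtain ⟨y1, y2⟩ := y
  simp only [LatticeAdj] at h
  have : (y1 = x1 + 1 ∧ y2 = x2) ∨ (y1 = x1 ∧ y2 = x2 + 1) ∨ (y1 = x1 - 1 ∧ y2 = x2) ∨
      (y1 = x1 ∧ y2 = x2 - 1) := by omega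
  rcases this with ⟨rfl, rfl⟩ | ⟨rfl, rfl⟩ | ⟨rfl, rfl⟩ | ⟨rfl, rfl⟩
  · exact ⟨0, by norm_num, by simp [dirVec]⟩
  · exact ⟨1, by norm_num, by simp [dirVec]⟩
  · exact ⟨2, by norm_num, by simp [dirVec, sub_eq_add_neg]⟩
  · exact ⟨3, by norm_num, by simp [dirVec, sub_eq_add_neg]⟩

theorem LatticeAdj.symm {x y : V} (h : LatticeAdj x y) : LatticeAdj y x := by
  simp only [LatticeAdj] at h ⊢
  omega

theorem dirIdx_dirVec {i : ℕ} (hi : i < 4) : dirIdx (dirVec i) = i := by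
  interval_cases i <;> simp [dirIdx, dirVec]

theorem dirVec_mod_inj {i j : ℕ} (h : dirVec i = dirVec j) : i % 4 = j % 4 := by
  have key : ∀ n, dirVec n = dirVec (n % 4) := fun n => by simp [dirVec]
  rw [key i, key j] at h
  rw [← dirIdx_dirVec (Nat.mod_lt i (by norm_num)), h, dirIdx_dirVec (Nat.mod_lt j (by norm_num))]

theorem fst_eq_of_mem_rbAt {a p c : V} {e : V × V} (h : e ∈ rbAt a p c) : e.1 = p := by
  simp only [rbAt, List.mem_map] at h
  obtain ⟨_, _, rfl⟩ := h
  rfl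

/-- The right boundary at a vertex contains neither the incoming nor the outgoing edge. -/
theorem snd_ne_of_mem_rbAt {a p c : V} (ha : LatticeAdj a p) (hc : LatticeAdj p c)
    {e : V × V} (h : e ∈ rbAt a p c) : e.2 ≠ a ∧ e.2 ≠ c := by
  obtain ⟨i, hi, rfl⟩ := ha.symm.exists_dirVec
  obtain ⟨j, hj, rfl⟩ := hc.exists_dirVec
  simp only [rbAt, List.mem_map, List.mem_filter, List.mem_range, decide_eq_true_eq,
    add_sub_cancel_left, dirIdx_dirVec hi, dirIdx_dirVec hj] at h
  obtain ⟨n, ⟨hn, hn1, hn2⟩, rfl⟩ := h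
  constructor
  · intro h
    have := dirVec_mod_inj (add_left_cancel h)
    omega
  · intro h
    have := dirVec_mod_inj (add_left_cancel h)
    split_ifs at hn2 <;> omega

theorem length_rbAt_le_two {a p c : V} (ha : LatticeAdj a p) (hc : LatticeAdj p c)
    (hac : a ≠ c) : (rbAt a p c).length ≤ 2 := by
  obtain ⟨i, hi, rfl⟩ := ha.symm.exists_dirVec
  obtain ⟨j, hj, rfl⟩ := hc.exists_dirVec
  have hij : i ≠ j := fun h => hac (by rw [h])
  simp only [rbAt, add_sub_cancel_left, dirIdx_dirVec hi, dirIdx_dirVec hj, List.length_map]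
  have h0 : (j + 4 - i) % 4 ≠ 0 := by omega
  have h4 : (j + 4 - i) % 4 < 4 := Nat.mod_lt _ (by norm_num)
  rw [if_neg h0]
  generalize (j + 4 - i) % 4 = b at h0 h4
  interval_cases b <;> simp [List.range_succ] at h0 ⊢

theorem steps_cons_cons (a b : V) (L : List V) : steps (a :: b :: L) = (a, b) :: steps (b :: L) :=
  rfl

theorem steps_append_cons (A : List V) (p : V) (D : List V) :
    steps (A ++ p :: D) = steps (A ++ [p]) ++ steps (p :: D) := by
  induction A with
  | nil => simp [steps]
  | cons a A ih =>
    cases A with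
    | nil => simp [steps]
    | cons b A => simpa [steps_cons_cons] using ih

theorem rightBoundary_append_cons_cons (A : List V) (b c : V) (D : List V) :
    rightBoundary (A ++ b :: c :: D) =
      rightBoundary (A ++ [b, c]) ++ rightBoundary (b :: c :: D) := by
  induction A with
  | nil => simp [rightBoundary]
  | cons a A ih =>
    rcases A with _ | ⟨d, _ | ⟨e, A⟩⟩
    · simp [rightBoundary]
    · simp [rightBoundary]
    · simpa [rightBoundary] using ih

theorem mem_of_mem_steps {L : List V} {s : V × V} (h : s ∈ steps L) : s.1 ∈ L ∧ s.2 ∈ L.tail :=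
  List.of_mem_zip h

theorem fst_mem_of_mem_steps_concat {A : List V} {p : V} {s : V × V}
    (h : s ∈ steps (A ++ [p])) : s.1 ∈ A := by
  induction A with
  | nil => simp [steps] at h
  | cons a A ih =>
    cases A with
    | nil =>
      simp [steps] at h
      simp [h]
    | cons b A =>
      simp only [List.cons_append, steps_cons_cons, List.mem_cons] at h ih ⊢
      rcases h with rfl | h
      · exact Or.inl rfl
      · exact Or.inr (ih h)

theorem fst_mem_tail_of_mem_rightBoundary {L : List V} {e : V × V} (h : e ∈ rightBoundary L) :
    e.1 ∈ L.tail := by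
  induction L with
  | nil => simp [rightBoundary] at h
  | cons a L ih =>
    rcases L with _ | ⟨b, _ | ⟨c, L⟩⟩
    · simp [rightBoundary] at h
    · simp [rightBoundary] at h
    · rw [rightBoundary, List.mem_append] at h
      rcases h with h | h
      · simp [fst_eq_of_mem_rbAt h]
      · exact List.mem_cons_of_mem _ (ih h)

theorem fst_mem_of_mem_rightBoundary_concat {A : List V} {p : V} {e : V × V}
    (h : e ∈ rightBoundary (A ++ [p])) : e.1 ∈ A := by
  induction A with
  | nil => simp [rightBoundary] at h
  | cons a A ih =>
    rcases A with _ | ⟨b, A⟩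
    · simp [rightBoundary] at h
    · obtain ⟨c, L, hL⟩ : ∃ c L, A ++ [p] = c :: L := List.exists_cons_of_ne_nil (by simp)
      simp only [List.cons_append, hL, rightBoundary, List.mem_append] at h ih
      rcases h with h | h
      · simp [fst_eq_of_mem_rbAt h]
      · exact List.mem_cons_of_mem _ (ih h)

theorem IsRightMost.of_append_right {B D : List V} (h : IsRightMost (B ++ D)) (hD : D ≠ []) :
    IsRightMost D := by
  obtain ⟨⟨-, hc⟩, hn, hr⟩ := h
  refine ⟨⟨hD, (List.isChain_append.1 hc).2.1⟩, ?_⟩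
  obtain ⟨p, D, rfl⟩ := List.exists_cons_of_ne_nil hD
  rw [steps_append_cons] at hn hr
  refine ⟨(List.nodup_append.1 hn).2.1, fun e he => ?_⟩
  have hmem : e ∈ rightBoundary (B ++ p :: D) := by
    rcases D with _ | ⟨c, D⟩
    · simp [rightBoundary] at he
    · rw [rightBoundary_append_cons_cons]
      exact List.mem_append_right _ he
  have := hr e hmem
  simp only [List.mem_append, not_or] at this
  exact ⟨this.1.2, this.2.2⟩

theorem rightBoundary_concat_subset (A : List V) (p : V) (C : List V) :
    rightBoundary (A ++ [p]) ⊆ rightBoundary (A ++ p :: C) := by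
  rcases List.eq_nil_or_concat A with rfl | ⟨A, a, rfl⟩
  · simp [rightBoundary]
  · simp only [List.concat_eq_append, List.append_assoc, List.cons_append, List.nil_append]
    rw [rightBoundary_append_cons_cons A a p C]
    exact List.subset_append_left _ _

theorem rightBoundary_cons_subset (B : List V) (p : V) (D : List V) :
    rightBoundary (p :: D) ⊆ rightBoundary (B ++ p :: D) := by
  rcases D with _ | ⟨c, D⟩
  · simp [rightBoundary]
  · rw [rightBoundary_append_cons_cons]
    exact List.subset_append_right _ _

theorem IsRightMost.of_append_left {A C : List V} {p : V} (h : IsRightMost (A ++ p :: C)) :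
    IsRightMost (A ++ [p]) := by
  obtain ⟨⟨-, hc⟩, hn, hr⟩ := h
  rw [steps_append_cons] at hn hr
  refine ⟨⟨by simp, ?_⟩, (List.nodup_append.1 hn).1, fun e he => ?_⟩
  · rw [List.append_cons] at hc
    exact (List.isChain_append.1 hc).1
  · have := hr e (rightBoundary_concat_subset A p C he)
    simp only [List.mem_append, not_or] at this
    exact ⟨this.1.1, this.2.1⟩

/-- The right boundary of a concatenation consists of the two right boundaries together with the
edges at the junction. -/
theorem rightBoundary_junction (A : List V) (a p c : V) (D : List V) :
    rightBoundary (A ++ a :: p :: c :: D) =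
      rightBoundary (A ++ [a, p]) ++ (rbAt a p c ++ rightBoundary (p :: c :: D)) := by
  rw [rightBoundary_append_cons_cons]
  rfl

/-- Two right-most paths glued at `p` form a right-most path when the first meets the second
only at `p` and neither revisits `p`. -/
theorem IsRightMost.glue {A D : List V} {p : V} (h₁ : IsRightMost (A ++ [p]))
    (h₂ : IsRightMost (p :: D)) (hA : ∀ a ∈ A, a ∉ p :: D) (hp : p ∉ D) :
    IsRightMost (A ++ p :: D) := by
  rcases List.eq_nil_or_concat A with rfl | ⟨A, a, rfl⟩
  · simpa using h₂
  rcases D with _ | ⟨c, D⟩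
  · exact h₁
  simp only [List.concat_eq_append, List.append_assoc, List.cons_append, List.nil_append]
    at h₁ hA ⊢
  obtain ⟨⟨-, hc₁⟩, hn₁, hr₁⟩ := h₁
  obtain ⟨⟨-, hc₂⟩, hn₂, hr₂⟩ := h₂
  have hs₁ : steps (A ++ [a, p]) = steps (A ++ [a]) ++ [(a, p)] := steps_append_cons A a [p]
  have hs : steps (A ++ a :: p :: c :: D) = steps (A ++ [a, p]) ++ steps (p :: c :: D) := by
    simpa using steps_append_cons (A ++ [a]) p (c :: D)
  have hap : LatticeAdj a p := by
    simpa using (List.isChain_append.1 hc₁).2.1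
  have hpc : LatticeAdj p c := (List.isChain_cons_cons.1 hc₂).1
  have hfst₁ : ∀ s ∈ steps (A ++ [a, p]), s.1 ∈ A ++ [a] := fun s hs =>
    fst_mem_of_mem_steps_concat (p := p) (by simpa using hs)
  have hsnd₁ : ∀ s ∈ steps (A ++ [a, p]), s.2 ∈ A ++ [a] ∨ s = (a, p) := fun s hs => by
    rw [hs₁, List.mem_append, List.mem_singleton] at hs
    exact hs.imp_left fun h => List.mem_of_mem_tail (mem_of_mem_steps h).2
  have hstep₂ : ∀ s ∈ steps (p :: c :: D), s.1 ∈ p :: c :: D ∧ s.2 ∈ c :: D := fun s hs =>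
    mem_of_mem_steps hs
  have hpA : p ∉ A ++ [a] := fun h => hA p h (by simp)
  refine ⟨⟨by simp, ?_⟩, ?_, ?_⟩
  · rw [show A ++ a :: p :: c :: D = (A ++ [a, p]) ++ c :: D by simp]
    refine List.isChain_append.2 ⟨hc₁, (List.isChain_cons_cons.1 hc₂).2, ?_⟩
    simpa using hpc
  · rw [hs]
    refine List.nodup_append.2 ⟨hn₁, hn₂, ?_⟩
    rintro s hs₁ _ hs₂ rfl
    exact hA _ (hfst₁ s hs₁) (hstep₂ s hs₂).1
  · intro e he
    rw [rightBoundary_junction, List.mem_append, List.mem_append] at he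
    rw [hs]
    simp only [List.mem_append, not_or]
    rcases he with he | he | he
    · have he1 : e.1 ∈ A ++ [a] :=
        fst_mem_of_mem_rightBoundary_concat (p := p) (by simpa using he)
      obtain ⟨h1, h2⟩ := hr₁ e he
      exact ⟨⟨h1, fun h => hA _ he1 (hstep₂ _ h).1⟩,
        h2, fun h => hA _ he1 (List.mem_cons_of_mem _ (hstep₂ _ h).2)⟩
    · obtain ⟨v, w⟩ := e
      obtain rfl : v = p := fst_eq_of_mem_rbAt he
      obtain ⟨hwa, hwc⟩ := snd_ne_of_mem_rbAt hap hpc he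
      refine ⟨⟨fun h => hpA (hfst₁ _ h), fun h => ?_⟩, fun h => ?_, fun h => hp (hstep₂ _ h).2⟩
      · rw [steps_cons_cons, List.mem_cons] at h
        rcases h with h | h
        · exact hwc (Prod.ext_iff.1 h).2
        · exact hp (mem_of_mem_steps h).1
      · rcases hsnd₁ _ h with h | h
        · exact hpA h
        · exact hwa (Prod.ext_iff.1 h).1
    · have he1 : e.1 ∈ c :: D := fst_mem_tail_of_mem_rightBoundary he
      obtain ⟨h1, h2⟩ := hr₂ e he
      refine ⟨⟨fun h => hA _ (hfst₁ _ h) (List.mem_cons_of_mem _ he1), h1⟩, fun h => ?_, h2⟩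
      rcases hsnd₁ _ h with h | h
      · exact hA _ h (List.mem_cons_of_mem _ he1)
      · have he1p : e.1 = p := (Prod.ext_iff.1 h).2
        exact hp (he1p ▸ he1)

/-- Gluing two paths at a vertex creates at most two right-boundary edges, provided the glued path
does not backtrack at that vertex. -/
theorem length_filter_rightBoundary_glue_le_two {A D : List V} {p : V}
    (h : (A ++ p :: D).IsChain LatticeAdj) (hA : ∀ a ∈ A, a ∉ D) (P : V × V → Bool)
    (h₁ : ∀ e ∈ rightBoundary (A ++ [p]), P e = false)
    (h₂ : ∀ e ∈ rightBoundary (p :: D), P e = false) :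
    ((rightBoundary (A ++ p :: D)).filter P).length ≤ 2 := by
  rcases List.eq_nil_or_concat A with rfl | ⟨A, a, rfl⟩
  · rw [List.nil_append, List.filter_eq_nil_iff.2 (by simpa using h₂)]
    simp
  rcases D with _ | ⟨c, D⟩
  · rw [List.filter_eq_nil_iff.2 (by simpa using h₁)]
    simp
  simp only [List.concat_eq_append, List.append_assoc, List.cons_append, List.nil_append]
    at h h₁ hA ⊢
  have h' := (List.isChain_append.1 h).2.1
  obtain ⟨hap, hpc, -⟩ := by simpa using h'
  have hnil₁ : (rightBoundary (A ++ [a, p])).filter P = [] :=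
    List.filter_eq_nil_iff.2 (by simpa using h₁)
  have hnil₂ : (rightBoundary (p :: c :: D)).filter P = [] :=
    List.filter_eq_nil_iff.2 (by simpa using h₂)
  rw [rightBoundary_junction, List.filter_append, List.filter_append,
    hnil₁, hnil₂, List.nil_append, List.append_nil]
  refine (List.length_filter_le _ _).trans (length_rbAt_le_two hap hpc ?_)
  rintro rfl
  exact hA a (by simp) (by simp)

/-- Lemma 2.5: `*`-concatenation of right-most paths. -/
theorem star_concatenation
    (x y z : V) (γ γ' : List V) (hγ : InR x y γ) (hγ' : InR y z γ')
    (k l : ℕ)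
    (hk1 : k < γ.length) (hk2 : γ.getD k 0 ∈ γ')
    (hk3 : ∀ i < k, γ.getD i 0 ∉ γ')
    (hl1 : l < γ'.length) (hl2 : γ'.getD l 0 = γ.getD k 0)
    (hl3 : ∀ j, l < j → j < γ'.length → γ'.getD j 0 ≠ γ.getD k 0) :
    InR x z (γ.take (k + 1) ++ γ'.drop (l + 1)) ∧
    ((rightBoundary (γ.take (k + 1) ++ γ'.drop (l + 1))).filter
        (fun e => decide (e ∉ rightBoundary γ ∧ e ∉ rightBoundary γ'))).length ≤ 2 := by
  obtain ⟨hr, hx, -⟩ := hγ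
  obtain ⟨hr', -, hz⟩ := hγ'
  rw [List.getD_eq_getElem _ _ hk1] at hl2 hl3
  rw [List.getD_eq_getElem _ _ hl1] at hl2
  obtain ⟨A, C, p, hA, hC, hp, hsplit⟩ : ∃ A C p, γ.take k = A ∧ γ.drop (k + 1) = C ∧
      γ[k] = p ∧ γ = A ++ p :: C :=
    ⟨_, _, _, rfl, rfl, rfl, by rw [List.getElem_cons_drop, List.take_append_drop]⟩
  obtain ⟨B, D, hD, hsplit'⟩ : ∃ B D, γ'.drop (l + 1) = D ∧ γ' = B ++ p :: D :=
    ⟨γ'.take l, _, rfl, by rw [← hp, ← hl2, List.getElem_cons_drop, List.take_append_drop]⟩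
  have hAγ' : ∀ a ∈ A, a ∉ γ' := by
    intro a ha
    rw [← hA] at ha
    obtain ⟨i, hi, rfl⟩ := List.mem_take_iff_getElem.1 ha
    have hi' : i < k := lt_of_lt_of_le hi (min_le_left _ _)
    have h := hk3 i hi'
    rwa [List.getD_eq_getElem _ _ (hi'.trans hk1)] at h
  have hpD : p ∉ D := by
    rw [← hD]
    intro h
    obtain ⟨i, hi, hpi⟩ := List.mem_drop_iff_getElem.1 h
    refine hl3 (l + 1 + i) (by omega) (by omega) ?_
    rw [List.getD_eq_getElem _ _ (by omega), hp]
    simpa [add_comm, add_left_comm] using hpi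
  have hpath : γ.take (k + 1) ++ γ'.drop (l + 1) = A ++ p :: D := by
    rw [List.take_succ_eq_append_getElem hk1, hA, hp, hD, List.append_assoc]
    rfl
  have hAD : ∀ a ∈ A, a ∉ p :: D := fun a ha h =>
    hAγ' a ha (hsplit' ▸ List.mem_append_right _ h)
  have hglue : IsRightMost (A ++ p :: D) :=
    (hsplit ▸ hr).of_append_left.glue ((hsplit' ▸ hr').of_append_right (by simp)) hAD hpD
  rw [hpath]
  refine ⟨⟨hglue, ?_, ?_⟩, ?_⟩
  · rw [hsplit] at hx
    cases A <;> simpa using hx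
  · rw [hsplit'] at hz
    simpa [List.getLast?_append] using hz
  · refine length_filter_rightBoundary_glue_le_two hglue.1.2
      (fun a ha h => hAD a ha (List.mem_cons_of_mem _ h)) _ (fun e he => ?_) (fun e he => ?_)
    · rw [decide_eq_false_iff_not, hsplit]
      exact fun h => h.1 (rightBoundary_concat_subset A p C he)
    · rw [decide_eq_false_iff_not, hsplit']
      exact fun h => h.2 (rightBoundary_cons_subset B p D he)

end Perc
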